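/- arXiv:2504.00142 — 3 statements merged into one kernel-verified Lean document; each statement's English description precedes it below -/
import Mathlib

section
/- For all points p, q ∈ ℍⁿ, exp_p(log_p(q)) = q; in particular, the exponential map at p is surjective from the tangent space at p onto ℍⁿ. -/
noncomputable def mink (n : ℕ) (x y : Fin (n+1) → ℝ) : ℝ :=
  -(x 0 * y 0) + ∑ i : Fin n, x i.succ * y i.succ

def Hyp (n : ℕ) : Set (Fin (n+1) → ℝ) :=
  {x | mink n x x = -1 ∧ 0 < x 0}

noncomputable def origin (n : ℕ) : Fin (n+1) → ℝ :=
  fun i => if i = 0 then 1 else 0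

noncomputable def mnorm (n : ℕ) (v : Fin (n+1) → ℝ) : ℝ :=
  Real.sqrt (mink n v v)

noncomputable def arcosh (x : ℝ) : ℝ :=
  Real.log (x + Real.sqrt (x ^ 2 - 1))

noncomputable def dH (n : ℕ) (c : ℝ) (p q : Fin (n+1) → ℝ) : ℝ :=
  (1 / Real.sqrt |c|) * arcosh (-(mink n p q))

noncomputable def expMap (n : ℕ) (c : ℝ) (p v : Fin (n+1) → ℝ) : Fin (n+1) → ℝ :=
  if v = 0 then p
  else Real.cosh (Real.sqrt |c| * mnorm n v) • p
    + (Real.sinh (Real.sqrt |c| * mnorm n v) / mnorm n v) • v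

noncomputable def logMap (n : ℕ) (c : ℝ) (p q : Fin (n+1) → ℝ) : Fin (n+1) → ℝ :=
  if q = p then 0
  else (dH n c p q / Real.sinh (Real.sqrt |c| * dH n c p q)) •
    (q - Real.cosh (Real.sqrt |c| * dH n c p q) • p)

noncomputable def proj (n : ℕ) (v : Fin (n+1) → ℝ) : Fin n → ℝ :=
  fun i => v i.succ

noncomputable def emb (d : ℕ) (w : Fin d → ℝ) : Fin (d+1) → ℝ :=
  Fin.cons 0 w

noncomputable def FW (n d : ℕ) (c : ℝ) (W : (Fin n → ℝ) →ₗ[ℝ] (Fin d → ℝ))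
    (x : Fin (n+1) → ℝ) : Fin (d+1) → ℝ :=
  expMap d c (origin d) (emb d (W (proj n (logMap n c (origin n) x))))

theorem mink_comm (n : ℕ) (x y : Fin (n+1) → ℝ) : mink n x y = mink n y x := by
  simp only [mink, mul_comm]

theorem mink_sub_right (n : ℕ) (x y z : Fin (n+1) → ℝ) :
    mink n x (y - z) = mink n x y - mink n x z := by
  simp only [mink, Pi.sub_apply, mul_sub, Finset.sum_sub_distrib]
  ring

theorem mink_smul_right (n : ℕ) (r : ℝ) (x y : Fin (n+1) → ℝ) :
    mink n x (r • y) = r * mink n x y := by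
  simp only [mink, Pi.smul_apply, smul_eq_mul, mul_add, Finset.mul_sum, mul_left_comm r]
  ring

theorem mink_smul_self (n : ℕ) (r : ℝ) (x : Fin (n+1) → ℝ) :
    mink n (r • x) (r • x) = r ^ 2 * mink n x x := by
  rw [mink_smul_right, mink_comm, mink_smul_right]
  ring

theorem mink_sub_smul_self (n : ℕ) (r : ℝ) (x y : Fin (n+1) → ℝ) :
    mink n (y - r • x) (y - r • x) = mink n y y - 2 * r * mink n x y + r ^ 2 * mink n x x := by
  rw [mink_sub_right, mink_smul_right, mink_comm n _ y, mink_comm n _ x, mink_sub_right,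
    mink_sub_right, mink_smul_right, mink_smul_right, mink_comm n y x]
  ring

theorem one_lt_neg_mink {n : ℕ} {p q : Fin (n+1) → ℝ} (hp : p ∈ Hyp n) (hq : q ∈ Hyp n)
    (hne : q ≠ p) : 1 < -mink n p q := by
  obtain ⟨hpp, hp0⟩ := hp
  obtain ⟨hqq, hq0⟩ := hq
  have hsum : ∑ i : Fin n, (p 0 * q i.succ - q 0 * p i.succ) ^ 2
      = p 0 ^ 2 * ∑ i : Fin n, q i.succ * q i.succ
        - 2 * p 0 * q 0 * ∑ i : Fin n, p i.succ * q i.succ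
        + q 0 ^ 2 * ∑ i : Fin n, p i.succ * p i.succ := by
    simp only [Finset.mul_sum, ← Finset.sum_sub_distrib, ← Finset.sum_add_distrib]
    exact Finset.sum_congr rfl fun i _ => by ring
  have key : 2 * (p 0 * q 0) * (-mink n p q - 1)
      = (p 0 - q 0) ^ 2 + ∑ i : Fin n, (p 0 * q i.succ - q 0 * p i.succ) ^ 2 := by
    rw [hsum]
    simp only [mink] at *
    linear_combination -p 0 ^ 2 * hqq - q 0 ^ 2 * hpp
  have hnonneg : 0 ≤ ∑ i : Fin n, (p 0 * q i.succ - q 0 * p i.succ) ^ 2 :=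
    Finset.sum_nonneg fun i _ => sq_nonneg _
  by_contra! hle
  have hmul : 2 * (p 0 * q 0) * (-mink n p q - 1) ≤ 0 :=
    mul_nonpos_of_nonneg_of_nonpos (by positivity) (by linarith)
  have h0 : p 0 = q 0 := by nlinarith [sq_nonneg (p 0 - q 0)]
  have hzero : ∑ i : Fin n, (p 0 * q i.succ - q 0 * p i.succ) ^ 2 = 0 := by
    nlinarith [sq_nonneg (p 0 - q 0)]
  rw [Finset.sum_eq_zero_iff_of_nonneg fun i _ => sq_nonneg _] at hzero
  refine hne (funext fun i => Fin.cases h0.symm (fun j => ?_) i)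
  have hj := pow_eq_zero_iff (two_ne_zero) |>.1 (hzero j (Finset.mem_univ j))
  rw [← h0, ← mul_sub] at hj
  exact sub_eq_zero.1 ((mul_eq_zero.1 hj).resolve_left hp0.ne')

theorem cosh_arcosh {x : ℝ} (hx : 1 ≤ x) : Real.cosh (arcosh x) = x :=
  Real.cosh_arcosh hx

theorem arcosh_pos {x : ℝ} (hx : 1 < x) : 0 < arcosh x :=
  Real.arcosh_pos hx

theorem sqrt_abs_mul_dH (n : ℕ) {c : ℝ} (hc : c ≠ 0) (p q : Fin (n+1) → ℝ) :
    Real.sqrt |c| * dH n c p q = arcosh (-mink n p q) := by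
  have hs : Real.sqrt |c| ≠ 0 := (Real.sqrt_pos.2 (abs_pos.2 hc)).ne'
  rw [dH]
  field_simp

theorem mink_logMap {n : ℕ} {c : ℝ} (hc : c ≠ 0) {p q : Fin (n+1) → ℝ} (hp : p ∈ Hyp n)
    (hq : q ∈ Hyp n) : mink n p (logMap n c p q) = 0 := by
  by_cases hne : q = p
  · simp [logMap, hne, mink]
  · rw [logMap, if_neg hne, sqrt_abs_mul_dH n hc, cosh_arcosh (one_lt_neg_mink hp hq hne).le,
      mink_smul_right, mink_sub_right, mink_smul_right, hp.1]
    ring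

theorem expMap_logMap {n : ℕ} {c : ℝ} (hc : c ≠ 0) {p q : Fin (n+1) → ℝ} (hp : p ∈ Hyp n)
    (hq : q ∈ Hyp n) : expMap n c p (logMap n c p q) = q := by
  by_cases hne : q = p
  · simp [logMap, expMap, hne]
  have ha := one_lt_neg_mink hp hq hne
  have hD := sqrt_abs_mul_dH n hc p q
  have hcosh := cosh_arcosh ha.le
  have hDpos := arcosh_pos ha
  have hS : 0 < Real.sinh (arcosh (-mink n p q)) := Real.sinh_pos_iff.2 hDpos
  have hd : 0 < dH n c p q := pos_of_mul_pos_right (hD ▸ hDpos) (Real.sqrt_nonneg _)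
  have hlog : logMap n c p q = (dH n c p q / Real.sinh (arcosh (-mink n p q))) •
      (q - (-mink n p q) • p) := by
    rw [logMap, if_neg hne, hD, hcosh]
  have hself : mink n (logMap n c p q) (logMap n c p q) = dH n c p q ^ 2 := by
    have hw : mink n (q - (-mink n p q) • p) (q - (-mink n p q) • p)
        = Real.sinh (arcosh (-mink n p q)) ^ 2 := by
      rw [mink_sub_smul_self, hp.1, hq.1, Real.sinh_sq, hcosh]
      ring
    rw [hlog, mink_smul_self, hw, div_pow, div_mul_cancel₀ _ (pow_ne_zero 2 hS.ne')]
  have hnorm : mnorm n (logMap n c p q) = dH n c p q := by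
    rw [mnorm, hself, Real.sqrt_sq hd.le]
  have hv : logMap n c p q ≠ 0 := by
    intro h
    have hzero : mnorm n (logMap n c p q) = 0 := by simp [h, mnorm, mink]
    exact hd.ne' (hnorm ▸ hzero)
  rw [expMap, if_neg hv, hnorm, hD, hcosh, hlog, smul_smul, div_mul_div_cancel₀ hd.ne',
    div_self hS.ne', one_smul, add_sub_cancel]

theorem stmt_6 (n : ℕ) (hn : 1 ≤ n) (c : ℝ) (hc : c < 0)
    (p : Fin (n+1) → ℝ) (hp : p ∈ Hyp n) :
    (∀ q ∈ Hyp n, expMap n c p (logMap n c p q) = q) ∧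
    Set.SurjOn (expMap n c p) {v : Fin (n+1) → ℝ | mink n p v = 0} (Hyp n) := by
  have hlog : ∀ q ∈ Hyp n, expMap n c p (logMap n c p q) = q :=
    fun _ hq => expMap_logMap hc.ne hp hq
  exact ⟨hlog, fun q hq => ⟨logMap n c p q, mink_logMap hc.ne hp hq, hlog q hq⟩⟩
end

section
/- (Proposition: injectivity of the Lorentzian transformation.) For every linear map W : ℝⁿ → ℝ^d, the Lorentzian transformation F_W : ℍⁿ → ℍ^d is injective if and only if W is injective (equivalently, W has full column rank n, which requires d ≥ n). -/
/-- The Euclidean norm on `Fin n → ℝ`, used as the norm of tangent vectors at the origin. -/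
noncomputable def euclNorm {n : ℕ} (w : Fin n → ℝ) : ℝ :=
  Real.sqrt (∑ i, w i * w i)

theorem sum_mul_self_nonneg {n : ℕ} (w : Fin n → ℝ) : 0 ≤ ∑ i, w i * w i :=
  Finset.sum_nonneg fun i _ => mul_self_nonneg (w i)

theorem euclNorm_nonneg {n : ℕ} (w : Fin n → ℝ) : 0 ≤ euclNorm w :=
  Real.sqrt_nonneg _

theorem euclNorm_mul_self {n : ℕ} (w : Fin n → ℝ) :
    euclNorm w * euclNorm w = ∑ i, w i * w i :=
  Real.mul_self_sqrt (sum_mul_self_nonneg w)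

theorem euclNorm_eq_zero {n : ℕ} {w : Fin n → ℝ} : euclNorm w = 0 ↔ w = 0 := by
  rw [euclNorm, Real.sqrt_eq_zero (sum_mul_self_nonneg w),
    Finset.sum_eq_zero_iff_of_nonneg fun i _ => mul_self_nonneg (w i)]
  simp [funext_iff]

theorem euclNorm_smul {n : ℕ} {t : ℝ} (ht : 0 ≤ t) (w : Fin n → ℝ) :
    euclNorm (t • w) = t * euclNorm w := by
  have h : ∑ i, (t • w) i * (t • w) i = t ^ 2 * ∑ i, w i * w i := by
    rw [Finset.mul_sum]
    exact Finset.sum_congr rfl fun i _ => by simp only [Pi.smul_apply, smul_eq_mul]; ring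
  rw [euclNorm, h, Real.sqrt_mul (sq_nonneg t), Real.sqrt_sq ht, euclNorm]

theorem mnorm_emb {d : ℕ} (w : Fin d → ℝ) : mnorm d (emb d w) = euclNorm w := by
  simp [mnorm, mink, emb, euclNorm]

theorem neg_mink_origin {n : ℕ} (x : Fin (n + 1) → ℝ) : -(mink n (origin n) x) = x 0 := by
  simp [mink, origin]

theorem emb_eq_zero {d : ℕ} {w : Fin d → ℝ} : emb d w = 0 ↔ w = 0 := by
  refine ⟨fun h => funext fun i => ?_, fun h => ?_⟩
  · simpa [emb] using congrFun h i.succ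
  · subst h
    funext i
    refine Fin.cases ?_ (fun j => ?_) i <;> simp [emb]

theorem expMap_emb_zero {d : ℕ} (c : ℝ) (w : Fin d → ℝ) :
    expMap d c (origin d) (emb d w) 0 = Real.cosh (Real.sqrt |c| * euclNorm w) := by
  by_cases hw : w = 0
  · simp [expMap, emb_eq_zero, hw, euclNorm_eq_zero.2, origin]
  · simp only [expMap, emb_eq_zero, hw, if_false, mnorm_emb]
    simp [origin, emb]

theorem expMap_emb_succ {d : ℕ} (c : ℝ) (w : Fin d → ℝ) (i : Fin d) :
    expMap d c (origin d) (emb d w) i.succ =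
      Real.sinh (Real.sqrt |c| * euclNorm w) / euclNorm w * w i := by
  by_cases hw : w = 0
  · simp [expMap, emb_eq_zero, hw, origin]
  · simp only [expMap, emb_eq_zero, hw, if_false, mnorm_emb]
    simp [origin, emb]

theorem arcosh_cosh {t : ℝ} (ht : 0 ≤ t) : arcosh (Real.cosh t) = t :=
  Real.arcosh_cosh ht

theorem expMap_emb_mem_Hyp {n : ℕ} (c : ℝ) (w : Fin n → ℝ) :
    expMap n c (origin n) (emb n w) ∈ Hyp n := by
  refine ⟨?_, by rw [expMap_emb_zero]; exact Real.cosh_pos _⟩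
  simp only [mink, expMap_emb_zero, expMap_emb_succ]
  have h : ∀ k : ℝ, ∑ i, k * w i * (k * w i) = k ^ 2 * (euclNorm w * euclNorm w) := fun k => by
    rw [euclNorm_mul_self, Finset.mul_sum]
    exact Finset.sum_congr rfl fun i _ => by ring
  rw [h]
  have hcs := Real.cosh_sq (Real.sqrt |c| * euclNorm w)
  by_cases hw : euclNorm w = 0
  · simp [hw]
  · field_simp
    linarith

/-- At the origin, the logarithmic map is a left inverse of the exponential map. -/
theorem proj_logMap_expMap_emb {n : ℕ} {c : ℝ} (hc : c < 0) (v : Fin n → ℝ) :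
    proj n (logMap n c (origin n) (expMap n c (origin n) (emb n v))) = v := by
  have hs : 0 < Real.sqrt |c| := Real.sqrt_pos.2 (abs_pos.2 hc.ne)
  by_cases hv : v = 0
  · subst hv
    have h0 : expMap n c (origin n) (emb n 0) = origin n := by
      simp [expMap, emb_eq_zero]
    rw [h0]
    funext i
    simp [logMap, proj]
  have hN : 0 < euclNorm v :=
    (euclNorm_nonneg v).lt_of_ne' fun h => hv (euclNorm_eq_zero.1 h)
  have hsN := mul_pos hs hN
  have hne : expMap n c (origin n) (emb n v) ≠ origin n := fun h => by
    have h0 := congrFun h 0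
    rw [expMap_emb_zero] at h0
    exact (Real.one_lt_cosh.2 hsN.ne').ne' (by simpa [origin] using h0)
  have hd : dH n c (origin n) (expMap n c (origin n) (emb n v)) = euclNorm v := by
    rw [dH, neg_mink_origin, expMap_emb_zero, arcosh_cosh hsN.le]
    field_simp
  have hsinh := (Real.sinh_pos_iff.2 hsN).ne'
  funext i
  simp only [logMap, hne, if_false, hd, proj, Pi.smul_apply, Pi.sub_apply, smul_eq_mul,
    expMap_emb_succ]
  simp only [origin, Fin.succ_ne_zero, if_false]
  field_simp
  ring

theorem exists_expMap_emb_eq {n : ℕ} {c : ℝ} (hc : c < 0) {x : Fin (n + 1) → ℝ}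
    (hx : x ∈ Hyp n) : ∃ v, expMap n c (origin n) (emb n v) = x := by
  have hs : 0 < Real.sqrt |c| := Real.sqrt_pos.2 (abs_pos.2 hc.ne)
  obtain ⟨hm, hpos⟩ := hx
  set r := euclNorm (proj n x) with hr
  have hr0 : 0 ≤ r := euclNorm_nonneg _
  have hx0 : x 0 = Real.cosh (Real.arsinh r) := by
    rw [Real.cosh_arsinh, eq_comm, Real.sqrt_eq_iff_mul_self_eq (by positivity) hpos.le, pow_two,
      hr, euclNorm_mul_self]
    simp only [mink] at hm
    simp only [proj]
    linarith
  have ha : 0 ≤ Real.arsinh r := Real.arsinh_nonneg_iff.2 hr0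
  refine ⟨(Real.arsinh r / (Real.sqrt |c| * r)) • proj n x, ?_⟩
  have hN : Real.sqrt |c| * euclNorm ((Real.arsinh r / (Real.sqrt |c| * r)) • proj n x) =
      Real.arsinh r := by
    rw [euclNorm_smul (by positivity), ← hr]
    by_cases h : r = 0
    · simp [h]
    · field_simp
  funext i
  refine Fin.cases ?_ (fun j => ?_) i
  · rw [expMap_emb_zero, hN, hx0]
  · rw [expMap_emb_succ, hN, euclNorm_smul (by positivity), ← hr, Real.sinh_arsinh]
    by_cases h : r = 0
    · have : x j.succ = 0 := congrFun (euclNorm_eq_zero.1 h) j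
      simp [proj, this]
    · have : Real.arsinh r ≠ 0 := fun h' => h (Real.arsinh_eq_zero_iff.1 h')
      simp only [Pi.smul_apply, smul_eq_mul, proj]
      field_simp

theorem stmt_11 (n d : ℕ) (hn : 1 ≤ n) (hd : 1 ≤ d) (c : ℝ) (hc : c < 0)
    (W : (Fin n → ℝ) →ₗ[ℝ] (Fin d → ℝ)) :
    Set.InjOn (FW n d c W) (Hyp n) ↔ Function.Injective W := by
  constructor
  · intro h v w hvw
    have key := h (expMap_emb_mem_Hyp c v) (expMap_emb_mem_Hyp c w)
      (by simp only [FW, proj_logMap_expMap_emb hc, hvw])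
    simpa only [proj_logMap_expMap_emb hc] using
      congrArg (fun x => proj n (logMap n c (origin n) x)) key
  · intro h x hx y hy hxy
    obtain ⟨v, rfl⟩ := exists_expMap_emb_eq hc hx
    obtain ⟨w, rfl⟩ := exists_expMap_emb_eq hc hy
    simp only [FW, proj_logMap_expMap_emb hc] at hxy
    have hW : W v = W w := by
      simpa only [proj_logMap_expMap_emb hc] using
        congrArg (fun x => proj d (logMap d c (origin d) x)) hxy
    rw [h hW]
end

section
/- If the linear map W : ℝⁿ → ℝ^d has a nonzero kernel vector v (so W does not have full column rank), then the point x = exp_{o_n}(ι_n(v)) ∈ ℍⁿ satisfies x ≠ o_n and F_W(x) = o_d = F_W(o_n); hence F_W is not injective. -/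
theorem mink_emb_self (n : ℕ) (v : Fin n → ℝ) :
    mink n (emb n v) (emb n v) = ∑ i, v i * v i := by
  simp [mink, emb]

theorem emb_zero (n : ℕ) : emb n 0 = 0 := by
  ext i
  cases i using Fin.cases <;> simp [emb]

theorem emb_ne_zero {n : ℕ} {v : Fin n → ℝ} (hv : v ≠ 0) : emb n v ≠ 0 := by
  intro h
  apply hv
  ext i
  simpa [emb] using congrFun h i.succ

theorem sum_mul_self_pos {n : ℕ} {v : Fin n → ℝ} (hv : v ≠ 0) : 0 < ∑ i, v i * v i := by
  obtain ⟨i, hi⟩ := Function.ne_iff.mp hv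
  exact Finset.sum_pos' (fun j _ => mul_self_nonneg _)
    ⟨i, Finset.mem_univ _, mul_self_pos.mpr hi⟩

theorem mnorm_emb_pos {n : ℕ} {v : Fin n → ℝ} (hv : v ≠ 0) : 0 < mnorm n (emb n v) := by
  rw [mnorm, mink_emb_self]
  exact Real.sqrt_pos.mpr (sum_mul_self_pos hv)

theorem mnorm_emb_sq (n : ℕ) (v : Fin n → ℝ) : mnorm n (emb n v) ^ 2 = ∑ i, v i * v i := by
  rw [mnorm, mink_emb_self]
  exact Real.sq_sqrt (Finset.sum_nonneg fun j _ => mul_self_nonneg _)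

theorem expMap_origin_emb_zero {n : ℕ} (c : ℝ) {v : Fin n → ℝ} (hv : v ≠ 0) :
    expMap n c (origin n) (emb n v) 0 = Real.cosh (√|c| * mnorm n (emb n v)) := by
  rw [expMap, if_neg (emb_ne_zero hv)]
  simp [origin, emb]

theorem expMap_origin_emb_succ {n : ℕ} (c : ℝ) {v : Fin n → ℝ} (hv : v ≠ 0) (i : Fin n) :
    expMap n c (origin n) (emb n v) i.succ =
      Real.sinh (√|c| * mnorm n (emb n v)) / mnorm n (emb n v) * v i := by
  rw [expMap, if_neg (emb_ne_zero hv)]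
  simp [origin, emb]

theorem origin_mem_Hyp (n : ℕ) : origin n ∈ Hyp n := by
  simp [Hyp, mink, origin]

theorem expMap_origin_emb_mem_Hyp {n : ℕ} (c : ℝ) {v : Fin n → ℝ} (hv : v ≠ 0) :
    expMap n c (origin n) (emb n v) ∈ Hyp n := by
  refine ⟨?_, ?_⟩
  · have hm := (mnorm_emb_pos hv).ne'
    simp only [mink, expMap_origin_emb_zero c hv, expMap_origin_emb_succ c hv,
      mul_mul_mul_comm _ (v _), ← Finset.mul_sum, ← mnorm_emb_sq]
    field_simp
    linarith [Real.cosh_sq (√|c| * mnorm n (emb n v))]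
  · rw [expMap_origin_emb_zero c hv]
    exact Real.cosh_pos _

theorem expMap_origin_emb_ne_origin {n : ℕ} {c : ℝ} (hc : c ≠ 0) {v : Fin n → ℝ} (hv : v ≠ 0) :
    expMap n c (origin n) (emb n v) ≠ origin n := by
  intro h
  have h0 := congrFun h 0
  rw [expMap_origin_emb_zero c hv] at h0
  have hpos : 0 < √|c| * mnorm n (emb n v) :=
    mul_pos (Real.sqrt_pos.mpr (abs_pos.mpr hc)) (mnorm_emb_pos hv)
  have := Real.one_lt_cosh.mpr hpos.ne'
  simp [origin] at h0
  linarith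

theorem exists_proj_logMap_origin (n : ℕ) (c : ℝ) (x : Fin (n + 1) → ℝ) :
    ∃ t : ℝ, proj n (logMap n c (origin n) x) = t • proj n x := by
  by_cases hx : x = origin n
  · refine ⟨0, ?_⟩
    ext i
    simp [proj, logMap, hx]
  · refine ⟨dH n c (origin n) x / Real.sinh (√|c| * dH n c (origin n) x), ?_⟩
    ext i
    simp [proj, logMap, hx, origin]

theorem FW_eq_origin_of_map_proj_eq_zero {n d : ℕ} (c : ℝ)
    (W : (Fin n → ℝ) →ₗ[ℝ] (Fin d → ℝ)) {x : Fin (n + 1) → ℝ} (hx : W (proj n x) = 0) :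
    FW n d c W x = origin d := by
  obtain ⟨t, ht⟩ := exists_proj_logMap_origin n c x
  rw [FW, ht, map_smul, hx, smul_zero, emb_zero, expMap, if_pos rfl]

theorem stmt_12 (n d : ℕ) (hn : 1 ≤ n) (hd : 1 ≤ d) (c : ℝ) (hc : c < 0)
    (W : (Fin n → ℝ) →ₗ[ℝ] (Fin d → ℝ)) (v : Fin n → ℝ) (hv : v ≠ 0) (hWv : W v = 0) :
    expMap n c (origin n) (emb n v) ∈ Hyp n ∧
    expMap n c (origin n) (emb n v) ≠ origin n ∧
    FW n d c W (expMap n c (origin n) (emb n v)) = origin d ∧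
    FW n d c W (origin n) = origin d ∧
    ¬ Set.InjOn (FW n d c W) (Hyp n) := by
  have hmem := expMap_origin_emb_mem_Hyp c hv
  have hne := expMap_origin_emb_ne_origin hc.ne hv
  have hx : FW n d c W (expMap n c (origin n) (emb n v)) = origin d := by
    apply FW_eq_origin_of_map_proj_eq_zero
    have hproj : proj n (expMap n c (origin n) (emb n v)) =
        (Real.sinh (√|c| * mnorm n (emb n v)) / mnorm n (emb n v)) • v :=
      funext fun i => expMap_origin_emb_succ c hv i
    rw [hproj, map_smul, hWv, smul_zero]
  have ho : FW n d c W (origin n) = origin d := by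
    apply FW_eq_origin_of_map_proj_eq_zero
    have hproj : proj n (origin n) = 0 := by
      ext i
      simp [proj, origin]
    rw [hproj, map_zero]
  exact ⟨hmem, hne, hx, ho, fun hinj => hne (hinj hmem (origin_mem_Hyp n) (hx.trans ho.symm))⟩
end
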